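/- For the Young function Φ(ξ) = ∑_{i=1}^N αᵢ|ξᵢ|^{pᵢ} with αᵢ > 0, pᵢ > 1, the Klimov symmetrization Φ♦, defined by Φ♦(|ξ|) = Φ•★•(ξ) (Young conjugation, then symmetric increasing rearrangement, then Young conjugation again), satisfies Φ♦(t) = Λ t^{p̄} for t ≥ 0, where p̄ is the harmonic mean of the pᵢ's and Λ is the explicit constant (2^{p̄}(p̄−1)^{p̄−1}/p̄^{p̄}) [∏ᵢ pᵢ^{1/pᵢ}(pᵢ')^{1/pᵢ'}Γ(1+1/pᵢ')/(ω_N Γ(1+N/p̄'))]^{p̄/N} (∏ᵢ αᵢ^{1/pᵢ})^{p̄/N}. -/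

import Mathlib

open MeasureTheory Real Set

/-- Young conjugate of `Φ : ℝ^N → ℝ`. -/
noncomputable def youngConj {N : ℕ} (Φ : EuclideanSpace ℝ (Fin N) → ℝ)
    (ξ' : EuclideanSpace ℝ (Fin N)) : ℝ :=
  sSup {r : ℝ | ∃ ξ : EuclideanSpace ℝ (Fin N), r = (∑ i, ξ i * ξ' i) - Φ ξ}

/-- Symmetric increasing rearrangement `h★` of `h : ℝ^N → ℝ`, defined by
`{h★ < t}` being the centered ball with the same measure as `{h < t}`. -/
noncomputable def incRearr {N : ℕ} (h : EuclideanSpace ℝ (Fin N) → ℝ)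
    (x : EuclideanSpace ℝ (Fin N)) : ℝ :=
  sSup {t : ℝ | (volume {y | h y < t}).toReal ≤
    (volume (Metric.ball (0 : EuclideanSpace ℝ (Fin N)) 1)).toReal * ‖x‖ ^ (N : ℝ)}

theorem integral_exp_neg_sum_mul_abs_rpow {N : ℕ} (c q : Fin N → ℝ) (hc : ∀ i, 0 < c i)
    (hq : ∀ i, 0 < q i) :
    ∫ y : Fin N → ℝ, exp (-∑ i, c i * |y i| ^ q i) =
      ∏ i, (2 * (c i ^ (-(1 / q i)) * Gamma (1 + 1 / q i))) := by
  simp_rw [← Finset.sum_neg_distrib, exp_sum]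
  rw [integral_fintype_prod_volume_eq_prod (fun i (x : ℝ) => exp (-(c i * |x| ^ q i)))]
  refine Finset.prod_congr rfl fun i _ => ?_
  rw [integral_comp_abs (f := fun x => exp (-(c i * x ^ q i)))]
  have h := integral_exp_neg_mul_rpow (hq i) (hc i)
  simp only [neg_mul] at h
  rw [h, add_comm, neg_div]

theorem volume_sum_mul_abs_rpow_lt_scale {N : ℕ} (c q : Fin N → ℝ)
    (hq : ∀ i, 0 < q i) {t : ℝ} (ht : 0 < t) :
    volume {y : Fin N → ℝ | ∑ i, c i * |y i| ^ q i < t} =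
      ENNReal.ofReal (t ^ ∑ i, 1 / q i) * volume {y : Fin N → ℝ | ∑ i, c i * |y i| ^ q i < 1} := by
  set D : Fin N → ℝ := fun i => t ^ (-(1 / q i)) with hD
  have hDpos : ∀ i, 0 < D i := fun i => rpow_pos_of_pos ht _
  have hdet : (Matrix.diagonal D).det = t ^ (-∑ i, 1 / q i) := by
    rw [Matrix.det_diagonal, ← Finset.sum_neg_distrib, rpow_sum_of_pos ht]
  have hdet0 : LinearMap.det (Matrix.toLin' (Matrix.diagonal D)) ≠ 0 := by
    rw [LinearMap.det_toLin', hdet]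
    exact (rpow_pos_of_pos ht _).ne'
  have key := Measure.addHaar_preimage_linearMap (volume : Measure (Fin N → ℝ)) hdet0
    {y : Fin N → ℝ | ∑ i, c i * |y i| ^ q i < 1}
  rw [LinearMap.det_toLin', hdet, rpow_neg ht.le, inv_inv, abs_of_pos (rpow_pos_of_pos ht _)] at key
  rw [← key]
  congr 1
  ext y
  have hterm : ∀ i, c i * |D i * y i| ^ q i = t⁻¹ * (c i * |y i| ^ q i) := fun i => by
    rw [abs_mul, abs_of_pos (hDpos i), mul_rpow (hDpos i).le (abs_nonneg _), hD, ← rpow_mul ht.le,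
      neg_mul, one_div_mul_cancel (hq i).ne', rpow_neg_one]
    ring
  simp only [mem_ofPred_eq, mem_preimage, Matrix.toLin'_apply, Matrix.mulVec_diagonal, hterm,
    ← Finset.mul_sum]
  rw [inv_mul_lt_iff₀ ht, mul_one]

theorem lintegral_exp_neg_eq_lintegral_volume_lt {α : Type*} [MeasurableSpace α] (μ : Measure α)
    [SFinite μ] {g : α → ℝ} (hg : Measurable g) :
    ∫⁻ y, ENNReal.ofReal (exp (-g y)) ∂μ =
      ∫⁻ t, ENNReal.ofReal (exp (-t)) * μ {y | g y < t} := by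
  have h1 : ∀ y, ENNReal.ofReal (exp (-g y)) =
      ∫⁻ t, {z : α × ℝ | g z.1 < z.2}.indicator (fun z => ENNReal.ofReal (exp (-z.2))) (y, t) := by
    intro y
    have : ∀ t, {z : α × ℝ | g z.1 < z.2}.indicator (fun z => ENNReal.ofReal (exp (-z.2))) (y, t) =
        (Ioi (g y)).indicator (fun t => ENNReal.ofReal (exp (-t))) t := fun t => by
      simp [indicator]
    simp_rw [this]
    rw [lintegral_indicator measurableSet_Ioi, ← integral_exp_neg_Ioi,
      ofReal_integral_eq_lintegral_ofReal (integrableOn_exp_neg_Ioi _)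
        (ae_of_all _ fun t => (exp_pos _).le)]
  simp_rw [h1]
  have hS : MeasurableSet {z : α × ℝ | g z.1 < z.2} :=
    measurableSet_lt (hg.comp measurable_fst) measurable_snd
  rw [lintegral_lintegral_swap]
  · refine lintegral_congr fun t => ?_
    have : ∀ y, {z : α × ℝ | g z.1 < z.2}.indicator (fun z => ENNReal.ofReal (exp (-z.2))) (y, t) =
        {y | g y < t}.indicator (fun _ => ENNReal.ofReal (exp (-t))) y := fun y => by
      simp [indicator]
    simp_rw [this]
    rw [lintegral_indicator (measurableSet_lt hg measurable_const), setLIntegral_const]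
  · exact (Measurable.indicator (by fun_prop) hS).aemeasurable

theorem volume_sum_mul_abs_rpow_lt_one {N : ℕ} (c q : Fin N → ℝ) (hc : ∀ i, 0 < c i)
    (hq : ∀ i, 0 < q i) :
    volume {y : Fin N → ℝ | ∑ i, c i * |y i| ^ q i < 1} =
      ENNReal.ofReal ((∏ i, (2 * (c i ^ (-(1 / q i)) * Gamma (1 + 1 / q i)))) /
        Gamma (1 + ∑ i, 1 / q i)) := by
  set V := volume {y : Fin N → ℝ | ∑ i, c i * |y i| ^ q i < 1}
  set σ := ∑ i, 1 / q i
  have hσ0 : 0 ≤ σ := Finset.sum_nonneg fun i _ => (one_div_pos.2 (hq i)).le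
  have hΓ : 0 < Gamma (1 + σ) := Gamma_pos_of_pos (by linarith)
  have hI := integral_exp_neg_sum_mul_abs_rpow c q hc hq
  have hPpos : 0 < ∏ i, (2 * (c i ^ (-(1 / q i)) * Gamma (1 + 1 / q i))) :=
    Finset.prod_pos fun i _ => mul_pos two_pos (mul_pos (rpow_pos_of_pos (hc i) _)
      (Gamma_pos_of_pos (by have := one_div_pos.2 (hq i); linarith)))
  have hintegrable : Integrable fun y : Fin N → ℝ => exp (-∑ i, c i * |y i| ^ q i) :=
    Integrable.of_integral_ne_zero (hI ▸ hPpos.ne')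
  have hg : Measurable fun y : Fin N → ℝ => ∑ i, c i * |y i| ^ q i := by fun_prop
  have hcake := lintegral_exp_neg_eq_lintegral_volume_lt volume hg
  rw [← ofReal_integral_eq_lintegral_ofReal hintegrable (ae_of_all _ fun y => (exp_pos _).le), hI] at hcake
  have hrhs : ∀ t : ℝ, ENNReal.ofReal (exp (-t)) *
      volume {y : Fin N → ℝ | ∑ i, c i * |y i| ^ q i < t} =
      (Ioi 0).indicator (fun t => ENNReal.ofReal (exp (-t) * t ^ (1 + σ - 1)) * V) t := by
    intro t
    by_cases ht : 0 < t
    · rw [indicator_of_mem (mem_Ioi.2 ht), volume_sum_mul_abs_rpow_lt_scale c q hq ht,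
        ENNReal.ofReal_mul (exp_pos _).le, mul_assoc, add_sub_cancel_left]
    · have : {y : Fin N → ℝ | ∑ i, c i * |y i| ^ q i < t} = ∅ := by
        refine eq_empty_of_forall_notMem fun y hy => ht (lt_of_le_of_lt ?_ hy)
        exact Finset.sum_nonneg fun i _ => mul_nonneg (hc i).le (rpow_nonneg (abs_nonneg _) _)
      rw [indicator_of_notMem (by simpa using ht), this, measure_empty, mul_zero]
  simp_rw [hrhs] at hcake
  rw [lintegral_indicator measurableSet_Ioi, lintegral_mul_const _ (by fun_prop),
    ← ofReal_integral_eq_lintegral_ofReal (GammaIntegral_convergent (by linarith))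
      ((ae_restrict_mem measurableSet_Ioi).mono fun t ht =>
        mul_nonneg (exp_pos _).le (rpow_nonneg (le_of_lt ht) _)),
    ← Gamma_eq_integral (by linarith)] at hcake
  rw [ENNReal.ofReal_div_of_pos hΓ, hcake, mul_comm, ENNReal.mul_div_cancel_right]
  · exact (ENNReal.ofReal_pos.2 hΓ).ne'
  · exact ENNReal.ofReal_ne_top

theorem toReal_volume_sum_mul_abs_rpow_lt {N : ℕ} (c q : Fin N → ℝ) (hc : ∀ i, 0 < c i)
    (hq : ∀ i, 0 < q i) {t : ℝ} (ht : 0 < t) :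
    (volume {y : EuclideanSpace ℝ (Fin N) | ∑ i, c i * |y i| ^ q i < t}).toReal =
      (∏ i, (2 * (c i ^ (-(1 / q i)) * Gamma (1 + 1 / q i)))) /
        Gamma (1 + ∑ i, 1 / q i) * t ^ ∑ i, 1 / q i := by
  have hmeas : MeasurableSet {y : Fin N → ℝ | ∑ i, c i * |y i| ^ q i < t} :=
    measurableSet_lt (by fun_prop) measurable_const
  have h := (PiLp.volume_preserving_ofLp (Fin N)).measure_preimage hmeas.nullMeasurableSet
  have hnn : 0 ≤ (∏ i, (2 * (c i ^ (-(1 / q i)) * Gamma (1 + 1 / q i)))) /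
      Gamma (1 + ∑ i, 1 / q i) := by
    have h1 : ∀ i, 0 ≤ 1 / q i := fun i => (one_div_pos.2 (hq i)).le
    have h2 : 0 ≤ ∑ i, 1 / q i := Finset.sum_nonneg fun i _ => h1 i
    refine div_nonneg (Finset.prod_nonneg fun i _ => mul_nonneg two_pos.le (mul_nonneg
      (rpow_nonneg (hc i).le _) (Gamma_nonneg_of_nonneg ?_))) (Gamma_nonneg_of_nonneg ?_)
    · linarith [h1 i]
    · linarith
  rw [preimage_ofPred_eq] at h
  rw [h, volume_sum_mul_abs_rpow_lt_scale c q hq ht, volume_sum_mul_abs_rpow_lt_one c q hc hq,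
    ENNReal.toReal_mul, ENNReal.toReal_ofReal hnn,
    ENNReal.toReal_ofReal (rpow_nonneg ht.le _), mul_comm]

theorem mul_le_mul_rpow_add_conj {a p q s t : ℝ} (ha : 0 < a) (hpq : p.HolderConjugate q)
    (ht : 0 ≤ t) (hs : 0 ≤ s) :
    t * s ≤ a * t ^ p + (a * p) ^ (-(q / p)) / q * s ^ q := by
  have hap : 0 < a * p := mul_pos ha hpq.pos
  have h := young_inequality_of_nonneg (a := (a * p) ^ (1 / p) * t)
    (b := (a * p) ^ (-(1 / p)) * s) (by positivity) (by positivity) hpq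
  rw [mul_rpow (by positivity) ht, mul_rpow (by positivity) hs, ← rpow_mul hap.le,
    ← rpow_mul hap.le, one_div_mul_cancel hpq.ne_zero, rpow_one] at h
  have h1 : (a * p) ^ (1 / p) * t * ((a * p) ^ (-(1 / p)) * s) = t * s := by
    rw [rpow_neg hap.le]
    field_simp
  have h2 : -(1 / p) * q = -(q / p) := by ring
  rw [h1, h2] at h
  have hp0 := hpq.ne_zero
  calc t * s ≤ _ := h
    _ = _ := by field_simp

theorem exists_mul_sub_mul_rpow_eq_conj {a p q s : ℝ} (ha : 0 < a) (hpq : p.HolderConjugate q)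
    (hs : 0 ≤ s) :
    ∃ t, 0 ≤ t ∧ t * s - a * t ^ p = (a * p) ^ (-(q / p)) / q * s ^ q := by
  have hap : 0 < a * p := mul_pos ha hpq.pos
  have hp0 := hpq.ne_zero
  have hq0 := hpq.symm.ne_zero
  rcases hs.eq_or_lt with rfl | hs
  · exact ⟨0, le_rfl, by simp [zero_rpow hp0, zero_rpow hq0]⟩
  obtain ⟨u, hu, rfl⟩ : ∃ u, 0 < u ∧ s = a * p * u :=
    ⟨s / (a * p), by positivity, by field_simp⟩
  refine ⟨u ^ (q / p), by positivity, ?_⟩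
  have hexp : q / p = q - 1 := hpq.symm.div_conj_eq_sub_one
  have h1 : u ^ (q / p) * u = u ^ q := by
    rw [hexp, rpow_sub_one hu.ne']
    field_simp
  have h2 : (u ^ (q / p)) ^ p = u ^ q := by
    rw [← rpow_mul hu.le, div_mul_cancel₀ _ hp0]
  have h3 : (a * p) ^ (-(q / p)) * (a * p) ^ q = a * p := by
    rw [← rpow_add hap, hexp]
    simp
  rw [mul_rpow hap.le hu.le, h2]
  have h4 : p / q = p - 1 := hpq.div_conj_eq_sub_one
  calc u ^ (q / p) * (a * p * u) - a * u ^ q = a * p * (u ^ (q / p) * u) - a * u ^ q := by ring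
    _ = a * (p / q) * u ^ q := by rw [h1, h4]; ring
    _ = (a * p) / q * u ^ q := by ring
    _ = ((a * p) ^ (-(q / p)) * (a * p) ^ q) / q * u ^ q := by rw [h3]
    _ = _ := by ring

theorem youngConj_sum_mul_abs_rpow {N : ℕ} {a p q : Fin N → ℝ} (ha : ∀ i, 0 < a i)
    (hpq : ∀ i, (p i).HolderConjugate (q i)) (η : EuclideanSpace ℝ (Fin N)) :
    youngConj (fun ξ => ∑ i, a i * |ξ i| ^ p i) η =
      ∑ i, (a i * p i) ^ (-(q i / p i)) / q i * |η i| ^ q i := by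
  refine IsGreatest.csSup_eq ⟨?_, ?_⟩
  · choose t ht hteq using fun i => exists_mul_sub_mul_rpow_eq_conj (ha i) (hpq i) (abs_nonneg (η i))
    refine ⟨WithLp.toLp 2 fun i => if 0 ≤ η i then t i else -t i, ?_⟩
    rw [← Finset.sum_sub_distrib]
    refine Finset.sum_congr rfl fun i _ => ?_
    rw [← hteq i]
    by_cases h : 0 ≤ η i
    · simp [h, abs_of_nonneg (ht i), abs_of_nonneg h]
    · simp [h, abs_of_nonneg (ht i), abs_of_neg (not_le.1 h)]
  · rintro _ ⟨ξ, rfl⟩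
    rw [← Finset.sum_sub_distrib]
    refine Finset.sum_le_sum fun i _ => ?_
    have h := mul_le_mul_rpow_add_conj (ha i) (hpq i) (abs_nonneg (ξ i)) (abs_nonneg (η i))
    have h' : ξ i * η i ≤ |ξ i| * |η i| := by
      rw [← abs_mul]
      exact le_abs_self _
    linarith

theorem youngConj_mul_norm_rpow {N : ℕ} {C p q : ℝ} (hC : 0 < C) (hpq : p.HolderConjugate q)
    (ξ : EuclideanSpace ℝ (Fin N)) :
    youngConj (fun x => C * ‖x‖ ^ p) ξ = (C * p) ^ (-(q / p)) / q * ‖ξ‖ ^ q := by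
  have hinner : ∀ x : EuclideanSpace ℝ (Fin N), ∑ i, x i * ξ i = inner ℝ x ξ := fun x => by
    simp [PiLp.inner_apply, mul_comm]
  refine IsGreatest.csSup_eq ⟨?_, ?_⟩
  · obtain ⟨t, ht, hteq⟩ := exists_mul_sub_mul_rpow_eq_conj hC hpq (norm_nonneg ξ)
    rw [← hteq]
    rcases eq_or_ne ξ 0 with rfl | hξ
    · refine ⟨0, ?_⟩
      rw [hteq]
      simp [zero_rpow hpq.ne_zero, zero_rpow hpq.symm.ne_zero]
    · refine ⟨(t / ‖ξ‖) • ξ, ?_⟩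
      have hξ' := norm_ne_zero_iff.2 hξ
      have hnorm : ‖(t / ‖ξ‖) • ξ‖ = t := by
        rw [norm_smul, norm_div, norm_norm, Real.norm_of_nonneg ht, div_mul_cancel₀ _ hξ']
      simp only [hnorm]
      rw [hinner, inner_smul_left, real_inner_self_eq_norm_sq]
      simp only [conj_trivial]
      field_simp
  · rintro _ ⟨x, rfl⟩
    have h := mul_le_mul_rpow_add_conj hC hpq (norm_nonneg x) (norm_nonneg ξ)
    have h' := real_inner_le_norm x ξ
    rw [hinner]
    linarith

theorem incRearr_eq_of_volume_lt {N : ℕ} {h : EuclideanSpace ℝ (Fin N) → ℝ} {V σ : ℝ} (hV : 0 < V)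
    (hσ : 0 < σ) (hnn : ∀ y, 0 ≤ h y)
    (hvol : ∀ t, 0 < t → (volume {y | h y < t}).toReal = V * t ^ σ)
    (x : EuclideanSpace ℝ (Fin N)) :
    incRearr h x = ((volume (Metric.ball (0 : EuclideanSpace ℝ (Fin N)) 1)).toReal / V) ^ (1 / σ) *
      ‖x‖ ^ (N / σ) := by
  set ω := (volume (Metric.ball (0 : EuclideanSpace ℝ (Fin N)) 1)).toReal with hω
  have hω0 : 0 ≤ ω := ENNReal.toReal_nonneg
  have hT : (ω / V) ^ (1 / σ) * ‖x‖ ^ (N / σ) = (ω * ‖x‖ ^ (N : ℝ) / V) ^ (1 / σ) := by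
    rw [mul_div_right_comm, mul_rpow (by positivity) (by positivity), ← rpow_mul (norm_nonneg x)]
    ring_nf
  rw [hT]
  have hR : 0 ≤ ω * ‖x‖ ^ (N : ℝ) / V := by positivity
  refine IsGreatest.csSup_eq ⟨?_, ?_⟩
  · show (volume {y | h y < (ω * ‖x‖ ^ (N : ℝ) / V) ^ (1 / σ)}).toReal ≤ ω * ‖x‖ ^ (N : ℝ)
    rcases (rpow_nonneg hR (1 / σ)).eq_or_lt with h0 | hpos
    · rw [← h0]
      simp only [not_lt.2 (hnn _), ofPred_false, measure_empty, ENNReal.toReal_zero]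
      positivity
    · rw [hvol _ hpos, ← rpow_mul hR, one_div_mul_cancel hσ.ne', rpow_one,
        mul_div_cancel₀ _ hV.ne']
  · intro t ht
    rcases le_or_gt t 0 with h0 | h0
    · exact h0.trans (rpow_nonneg hR _)
    · have ht' : (volume {y | h y < t}).toReal ≤ ω * ‖x‖ ^ (N : ℝ) := ht
      rw [hvol t h0, ← le_div_iff₀' hV] at ht'
      calc t = (t ^ σ) ^ (1 / σ) := by rw [← rpow_mul h0.le, mul_one_div_cancel hσ.ne', rpow_one]
        _ ≤ _ := rpow_le_rpow (by positivity) ht' (by positivity)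

/-- The Klimov symmetrization `Φ♦ = Φ•★•` of `Φ(ξ) = ∑ αᵢ|ξᵢ|^{pᵢ}` satisfies
`Φ♦(|ξ|) = Λ |ξ|^p̄` with the explicit constant `Λ`. -/
theorem stmt9 (N : ℕ) (hN : 2 ≤ N) (α p p' : Fin N → ℝ)
    (hα : ∀ i, 0 < α i) (hp : ∀ i, 1 < p i)
    (hp' : ∀ i, p' i = p i / (p i - 1))
    (pb : ℝ) (hpb : 1 / pb = (1 / (N : ℝ)) * ∑ i, 1 / p i)
    (pb' : ℝ) (hpb' : pb' = pb / (pb - 1))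
    (ωN : ℝ) (hω : ωN = (volume (Metric.ball (0 : EuclideanSpace ℝ (Fin N)) 1)).toReal)
    (Λ : ℝ)
    (hΛ : Λ = (2 ^ pb * (pb - 1) ^ (pb - 1) / pb ^ pb) *
      ((∏ i, (p i) ^ (1 / p i) * (p' i) ^ (1 / p' i) * Real.Gamma (1 + 1 / p' i)) /
        (ωN * Real.Gamma (1 + (N : ℝ) / pb'))) ^ (pb / (N : ℝ)) *
      (∏ i, (α i) ^ (1 / p i)) ^ (pb / (N : ℝ)))
    (Φ : EuclideanSpace ℝ (Fin N) → ℝ)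
    (hΦ : ∀ ξ, Φ ξ = ∑ i, α i * |ξ i| ^ (p i)) :
    ∀ ξ : EuclideanSpace ℝ (Fin N),
      youngConj (incRearr (youngConj Φ)) ξ = Λ * ‖ξ‖ ^ pb := by
  have hpq : ∀ i, (p i).HolderConjugate (p' i) := fun i =>
    (holderConjugate_iff_eq_conjExponent (hp i)).2 (hp' i)
  have hN0 : (0 : ℝ) < N := by exact_mod_cast (by omega : 0 < N)
  have : Nonempty (Fin N) := ⟨⟨0, by omega⟩⟩
  have hsum_pos : 0 < ∑ i, 1 / p i :=
    Finset.sum_pos (fun i _ => one_div_pos.2 (hpq i).pos) Finset.univ_nonempty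
  have hsum_lt : ∑ i, 1 / p i < N := by
    calc ∑ i, 1 / p i < ∑ _i : Fin N, (1 : ℝ) :=
          Finset.sum_lt_sum_of_nonempty Finset.univ_nonempty fun i _ =>
            (div_lt_one (hpq i).pos).2 (hp i)
      _ = N := by simp
  have hpb0 : 0 < pb := by
    rw [← one_div_pos, hpb]
    positivity
  have hpb1 : 1 < pb := by
    rw [← div_lt_one hpb0, hpb, one_div_mul_eq_div]
    exact (div_lt_one hN0).2 hsum_lt
  have hpbq : pb.HolderConjugate pb' := (holderConjugate_iff_eq_conjExponent hpb1).2 hpb'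
  have hpb'0 := hpbq.symm.pos
  have hσ : ∑ i, 1 / p' i = N / pb' := by
    have h1 : ∀ i, 1 / p' i = 1 - 1 / p i := fun i => by
      have := (hpq i).inv_add_inv_eq_one
      simp only [one_div]
      linarith
    have h2 : ∑ i, 1 / p i = N * (1 / pb) := by rw [hpb]; field_simp
    have h3 : 1 / pb' = 1 - 1 / pb := by
      have := hpbq.inv_add_inv_eq_one
      simp only [one_div]
      linarith
    simp_rw [h1]
    rw [Finset.sum_sub_distrib, h2, div_eq_mul_one_div (N : ℝ) pb', h3]
    simp
    ring
  set c : Fin N → ℝ := fun i => (α i * p i) ^ (-(p' i / p i)) / p' i with hc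
  have hcpos : ∀ i, 0 < c i := fun i =>
    div_pos (rpow_pos_of_pos (mul_pos (hα i) (hpq i).pos) _) (hpq i).symm.pos
  have hconj : youngConj Φ = fun η => ∑ i, c i * |η i| ^ p' i := by
    obtain rfl : Φ = fun ξ => ∑ i, α i * |ξ i| ^ p i := funext hΦ
    exact funext fun η => youngConj_sum_mul_abs_rpow hα hpq η
  set A := ∏ i, (p i) ^ (1 / p i) * (p' i) ^ (1 / p' i) * Real.Gamma (1 + 1 / p' i) with hA
  set B := ∏ i, (α i) ^ (1 / p i) with hB
  set G := Real.Gamma (1 + (N : ℝ) / pb') with hG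
  have hA0 : 0 < A := Finset.prod_pos fun i _ => by
    have h1 := (hpq i).pos
    have h2 := (hpq i).symm.pos
    have h3 : 0 < Real.Gamma (1 + 1 / p' i) := Gamma_pos_of_pos (by positivity)
    positivity
  have hB0 : 0 < B := Finset.prod_pos fun i _ => rpow_pos_of_pos (hα i) _
  have hG0 : 0 < G := Gamma_pos_of_pos (by positivity)
  have hω0 : 0 < ωN := hω ▸ ENNReal.toReal_pos (Metric.measure_ball_pos _ _ one_pos).ne'
    measure_ball_lt_top.ne
  have hprod : ∏ i, (2 * (c i ^ (-(1 / p' i)) * Real.Gamma (1 + 1 / p' i))) = 2 ^ N * A * B := by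
    rw [hA, hB, mul_assoc, ← Finset.prod_mul_distrib, Finset.prod_mul_distrib, Finset.prod_const,
      Finset.card_univ, Fintype.card_fin]
    congr 1
    refine Finset.prod_congr rfl fun i _ => ?_
    have h1 := (hpq i).pos
    have h2 := (hpq i).symm.pos
    have h3 : 0 < α i * p i := mul_pos (hα i) h1
    have h4 : -(p' i / p i) * -(1 / p' i) = 1 / p i := by field_simp
    have h5 : c i ^ (-(1 / p' i)) = (α i) ^ (1 / p i) * (p i) ^ (1 / p i) * (p' i) ^ (1 / p' i) := by
      rw [hc, div_rpow (by positivity) h2.le, ← rpow_mul h3.le, h4, rpow_neg h2.le, div_inv_eq_mul,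
        mul_rpow (hα i).le h1.le]
    rw [h5]
    ring
  set V := 2 ^ N * A * B / G with hV
  have hV0 : 0 < V := by positivity
  have hσ0 : 0 < (N : ℝ) / pb' := by positivity
  have hrearr : incRearr (youngConj Φ) = fun x => (ωN / V) ^ (pb' / N) * ‖x‖ ^ pb' := by
    funext x
    rw [incRearr_eq_of_volume_lt (V := V) (σ := N / pb') hV0 hσ0, ← hω]
    · congr 2 <;> field_simp
    · intro y
      rw [hconj]
      exact Finset.sum_nonneg fun i _ => mul_nonneg (hcpos i).le (rpow_nonneg (abs_nonneg _) _)
    · intro t ht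
      rw [hconj, toReal_volume_sum_mul_abs_rpow_lt c p' hcpos (fun i => (hpq i).symm.pos) ht, hσ,
        hprod]
  intro ξ
  rw [hrearr, youngConj_mul_norm_rpow (by positivity) hpbq.symm]
  congr 1
  have hVω : ωN / V = ((2 : ℝ) ^ N * (A / (ωN * G)) * B)⁻¹ := by
    rw [hV]
    field_simp
  have hexp : pb' / N * -(pb / pb') = -(pb / N) := by field_simp
  have h2 : ((2 : ℝ) ^ N) ^ (pb / N) = 2 ^ pb := by
    rw [← rpow_natCast, ← rpow_mul two_pos.le, mul_div_cancel₀ _ hN0.ne']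
  have hpbsub : 0 < pb - 1 := sub_pos.2 hpb1
  have hconst : pb' ^ (-(pb / pb')) / pb = (pb - 1) ^ (pb - 1) / pb ^ pb := by
    rw [hpbq.div_conj_eq_sub_one, hpb', rpow_neg (by positivity), div_rpow hpb0.le hpbsub.le,
      inv_div, div_div, ← rpow_add_one hpb0.ne', sub_add_cancel]
  rw [mul_rpow (by positivity) hpb'0.le, ← rpow_mul (by positivity), hexp, hVω,
    inv_rpow (by positivity), rpow_neg (by positivity), inv_inv, mul_rpow (by positivity) hB0.le,
    mul_rpow (by positivity) (by positivity), h2, mul_div_assoc, hconst, hΛ]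
  ring
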